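/- The alternating group A_7 is not a quotient of the triangle group T(2,3,7); equivalently, there do not exist elements a, b ∈ A_7 with a² = 1, b³ = 1, (ab)⁷ = 1, and ⟨a, b⟩ = A_7. -/

import Mathlib

/-- The relations of the triangle group `T(2,3,7)`. -/
def T237rels : Set (FreeGroup (Fin 3)) :=
  {FreeGroup.of 0 ^ 2, FreeGroup.of 1 ^ 3, FreeGroup.of 2 ^ 7,
    FreeGroup.of 0 * FreeGroup.of 1 * FreeGroup.of 2}

open scoped Pointwise

/-- The Fano plane on `Fin 7` whose lines are the translates of `{0, d, 3 * d}`. -/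
def cyclicFano (d : Fin 7) : Finset (Finset (Fin 7)) :=
  Finset.univ.image fun i => {i, i + d, i + 3 * d}

lemma finRotate_smul_cyclicFano (d : Fin 7) :
    finRotate 7 • cyclicFano d = cyclicFano d := by
  revert d
  decide +kernel

set_option synthInstance.maxSize 2000 in
set_option synthInstance.maxHeartbeats 400000 in
lemma image_cyclicFano_of_values : ∀ y₀ y₁ : Fin 7, (y₀ = 1 ↔ y₁ = 0) →
    ∀ y₂, (y₀ = 2 ↔ y₂ = 0) → (y₁ = 2 ↔ y₂ = 1) →
    ∀ y₃, (y₀ = 3 ↔ y₃ = 0) → (y₁ = 3 ↔ y₃ = 1) → (y₂ = 3 ↔ y₃ = 2) →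
    ∀ y₄, (y₀ = 4 ↔ y₄ = 0) → (y₁ = 4 ↔ y₄ = 1) → (y₂ = 4 ↔ y₄ = 2) → (y₃ = 4 ↔ y₄ = 3) →
    ∀ y₅, (y₀ = 5 ↔ y₅ = 0) → (y₁ = 5 ↔ y₅ = 1) → (y₂ = 5 ↔ y₅ = 2) → (y₃ = 5 ↔ y₅ = 3) →
      (y₄ = 5 ↔ y₅ = 4) →
    ∀ y₆, (y₀ = 6 ↔ y₆ = 0) → (y₁ = 6 ↔ y₆ = 1) → (y₂ = 6 ↔ y₆ = 2) → (y₃ = 6 ↔ y₆ = 3) →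
      (y₄ = 6 ↔ y₆ = 4) → (y₅ = 6 ↔ y₆ = 5) →
    (∀ x : Fin 7, ![y₀, y₁, y₂, y₃, y₄, y₅, y₆] (![y₀, y₁, y₂, y₃, y₄, y₅, y₆]
      (![y₀, y₁, y₂, y₃, y₄, y₅, y₆] (x + 1) + 1) + 1) = x) →
    ∃ d ∈ ({1, 6} : Finset (Fin 7)), (cyclicFano d).image
      (Finset.image ![y₀, y₁, y₂, y₃, y₄, y₅, y₆]) = cyclicFano d := by
  decide +kernel

lemma exists_smul_cyclicFano_eq {a : Equiv.Perm (Fin 7)} (ha : a ^ 2 = 1)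
    (hac : (a * finRotate 7) ^ 3 = 1) :
    ∃ d ∈ ({1, 6} : Finset (Fin 7)), a • cyclicFano d = cyclicFano d := by
  have hinv : ∀ x, a (a x) = x := fun x => by
    simpa [pow_two] using Equiv.congr_fun ha x
  have hiff : ∀ i j, a i = j ↔ a j = i := fun i j =>
    ⟨fun h => h ▸ hinv i, fun h => h ▸ hinv j⟩
  have hvec : ![a 0, a 1, a 2, a 3, a 4, a 5, a 6] = a := by
    ext x
    fin_cases x <;> rfl
  have hcube : ∀ x, a (a (a (x + 1) + 1) + 1) = x := fun x => by
    simpa [pow_succ] using Equiv.congr_fun hac x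
  have key := image_cyclicFano_of_values (a 0) (a 1) (hiff _ _) (a 2) (hiff _ _) (hiff _ _)
    (a 3) (hiff _ _) (hiff _ _) (hiff _ _) (a 4) (hiff _ _) (hiff _ _) (hiff _ _) (hiff _ _)
    (a 5) (hiff _ _) (hiff _ _) (hiff _ _) (hiff _ _) (hiff _ _)
    (a 6) (hiff _ _) (hiff _ _) (hiff _ _) (hiff _ _) (hiff _ _) (hiff _ _)
  rw [hvec] at key
  exact key hcube

lemma exists_alternatingGroup_smul_cyclicFano_ne {d : Fin 7}
    (hd : d ∈ ({1, 6} : Finset (Fin 7))) :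
    ∃ x ∈ alternatingGroup (Fin 7), x • cyclicFano d ≠ cyclicFano d := by
  refine ⟨Equiv.swap 0 1 * Equiv.swap 1 2, ?_, ?_⟩
  · rw [Equiv.Perm.mem_alternatingGroup]
    decide +kernel
  · revert d
    decide +kernel

lemma isConj_finRotate_of_pow_eq_one {c : Equiv.Perm (Fin 7)} (hc : c ^ 7 = 1) (hc1 : c ≠ 1) :
    IsConj c (finRotate 7) := by
  have : Fact (Nat.Prime 7) := ⟨by norm_num⟩
  have horder : orderOf c = 7 := orderOf_eq_prime hc hc1
  obtain ⟨n, hn⟩ := Equiv.Perm.cycleType_prime_order (σ := c) (by rw [horder]; norm_num)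
  have hsum := Equiv.Perm.sum_cycleType_le c
  rw [hn, horder] at hsum
  have hn0 : n = 0 := by
    simp at hsum
    omega
  rw [Equiv.Perm.isConj_iff_cycleType_eq, hn, horder, hn0, cycleType_finRotate]
  rfl

lemma closure_pair_ne_top {a b : alternatingGroup (Fin 7)} (ha : a ^ 2 = 1) (hb : b ^ 3 = 1)
    (hab : (a * b) ^ 7 = 1) : Subgroup.closure {a, b} ≠ ⊤ := by
  intro htop
  by_cases hc1 : a * b = 1
  · have hba : b = a := by
      rw [← mul_right_inj a, hc1, ← pow_two, ha]
    have ha1 : a = 1 := by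
      rw [hba, pow_succ, ha, one_mul] at hb
      exact hb
    rw [hba, ha1] at htop
    rw [Set.pair_eq_singleton, Subgroup.closure_singleton_one] at htop
    exact bot_ne_top htop
  · obtain ⟨g, hg⟩ := isConj_iff.1 <| isConj_finRotate_of_pow_eq_one
      (c := ((a * b : alternatingGroup (Fin 7)) : Equiv.Perm (Fin 7)))
      (by exact_mod_cast congrArg Subtype.val hab) (by exact_mod_cast hc1)
    let φ : alternatingGroup (Fin 7) →* Equiv.Perm (Fin 7) :=
      (MulAut.conj g).toMonoidHom.comp (alternatingGroup (Fin 7)).subtype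
    have hφab : φ a * φ b = finRotate 7 := by
      rw [← map_mul]
      exact hg
    have hφa : φ a ^ 2 = 1 := by rw [← map_pow, ha, map_one]
    have hφb : φ a * finRotate 7 = φ b := by
      rw [← hφab, ← mul_assoc, ← pow_two, hφa, one_mul]
    obtain ⟨d, hd, hda⟩ := exists_smul_cyclicFano_eq hφa
      (by rw [hφb, ← map_pow, hb, map_one])
    have hle : Subgroup.closure {a, b} ≤
        (MulAction.stabilizer (Equiv.Perm (Fin 7)) (cyclicFano d)).comap φ := by
      rw [Subgroup.closure_le]
      rintro x (rfl | rfl)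
      · exact hda
      · change φ x • cyclicFano d = cyclicFano d
        rw [← hφb, mul_smul, finRotate_smul_cyclicFano, hda]
    obtain ⟨x, hx, hxd⟩ := exists_alternatingGroup_smul_cyclicFano_ne hd
    have hmem := hle (htop ▸ Subgroup.mem_top
      (⟨g⁻¹ * x * g, by simpa using (inferInstance :
        (alternatingGroup (Fin 7)).Normal).conj_mem x hx g⁻¹⟩ : alternatingGroup (Fin 7)))
    apply hxd
    have hφx : (g * (g⁻¹ * x * g) * g⁻¹) • cyclicFano d = cyclicFano d := hmem
    simpa [mul_assoc] using hφx

theorem stmt14 :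
    (¬ ∃ f : PresentedGroup T237rels →* alternatingGroup (Fin 7),
        Function.Surjective f) ∧
    ¬ ∃ a b : alternatingGroup (Fin 7),
        a ^ 2 = 1 ∧ b ^ 3 = 1 ∧ (a * b) ^ 7 = 1 ∧
        Subgroup.closure {a, b} = ⊤ := by
  refine ⟨?_, fun ⟨a, b, ha, hb, hab, htop⟩ => closure_pair_ne_top ha hb hab htop⟩
  rintro ⟨f, hf⟩
  let t : Fin 3 → PresentedGroup T237rels := PresentedGroup.of
  have h0 : t 0 ^ 2 = 1 :=
    PresentedGroup.one_of_mem (x := FreeGroup.of 0 ^ 2) (by simp [T237rels])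
  have h1 : t 1 ^ 3 = 1 :=
    PresentedGroup.one_of_mem (x := FreeGroup.of 1 ^ 3) (by simp [T237rels])
  have h2 : t 2 ^ 7 = 1 :=
    PresentedGroup.one_of_mem (x := FreeGroup.of 2 ^ 7) (by simp [T237rels])
  have h012 : t 0 * t 1 * t 2 = 1 :=
    PresentedGroup.one_of_mem (x := FreeGroup.of 0 * FreeGroup.of 1 * FreeGroup.of 2)
      (by simp [T237rels])
  have h01 : t 0 * t 1 = (t 2)⁻¹ := eq_inv_of_mul_eq_one_left h012
  refine closure_pair_ne_top (a := f (t 0)) (b := f (t 1)) (by rw [← map_pow, h0, map_one])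
    (by rw [← map_pow, h1, map_one])
    (by rw [← map_mul, h01, ← map_pow, inv_pow, h2, inv_one, map_one]) ?_
  rw [eq_top_iff, ← MonoidHom.range_eq_top.2 hf, MonoidHom.range_eq_map,
    ← PresentedGroup.closure_range_of, MonoidHom.map_closure, Subgroup.closure_le]
  rintro _ ⟨_, ⟨i, rfl⟩, rfl⟩
  have m0 : f (t 0) ∈ Subgroup.closure {f (t 0), f (t 1)} := Subgroup.subset_closure (by simp)
  have m1 : f (t 1) ∈ Subgroup.closure {f (t 0), f (t 1)} := Subgroup.subset_closure (by simp)
  have m2 : f (t 2) ∈ Subgroup.closure {f (t 0), f (t 1)} := by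
    rw [← inv_inv (t 2), ← h01, map_inv, map_mul]
    exact inv_mem (mul_mem m0 m1)
  fin_cases i
  exacts [m0, m1, m2]
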